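/- Let Λ(z₁,…,z_l) be the exterior algebra over Q on l generators of odd degree and r ≥ 2 an integer. Then the kernel of the r-fold multiplication μ^r: (Λ(z₁,…,z_l))^{⊗r} → Λ(z₁,…,z_l) satisfies (ker μ^r)^{l(r−1)+1} = 0. In particular, for a single odd generator u, (ker μ^r_{Λu})^r = 0. -/

import Mathlib

noncomputable section

namespace RHT

/-- A graded-commutative algebra over `ℚ`, graded by `ℕ`. -/
class GCA (A : Type) extends Ring A, Algebra ℚ A where
  grading : ℕ → Submodule ℚ A
  gradedAlgebra : GradedAlgebra grading
  grading_comm : ∀ (i j : ℕ) (a b : A), a ∈ grading i → b ∈ grading j →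
    a * b = ((-1 : ℚ) ^ (i * j)) • (b * a)

/-- The grading of a graded-commutative algebra, with the algebra explicit. -/
def Grc (A : Type) [GCA A] : ℕ → Submodule ℚ A := GCA.grading

/-- Morphisms of graded algebras: `ℚ`-algebra morphisms preserving the
grading. -/
def IsGCAHom {A B : Type} [GCA A] [GCA B] (f : A →ₐ[ℚ] B) : Prop :=
  ∀ (i : ℕ) (a : A), a ∈ Grc A i → f a ∈ Grc B i

theorem isGCAHom_id (A : Type) [GCA A] : IsGCAHom (AlgHom.id ℚ A) :=
  fun _ _ h => h

/-- `A` is of finite type: each graded piece is finite-dimensional. -/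
def FiniteType (A : Type) [GCA A] : Prop :=
  ∀ n, FiniteDimensional ℚ (Grc A n)

/-- `T`, together with the morphisms `ι j : A → T`, is the `r`-fold graded
tensor power of `A`, characterized as the `r`-fold coproduct of copies of `A`
in the category of graded-commutative algebras. -/
structure GTensorPower (A : Type) [GCA A] (r : ℕ) (T : Type) [GCA T] where
  ι : Fin r → (A →ₐ[ℚ] T)
  ι_hom : ∀ j, IsGCAHom (ι j)
  coprod : ∀ (B : Type) [GCA B] (f : Fin r → (A →ₐ[ℚ] B)), (∀ j, IsGCAHom (f j)) →
    ∃! g : T →ₐ[ℚ] B, IsGCAHom g ∧ ∀ j, g.comp (ι j) = f j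

/-- The `r`-fold multiplication morphism `μ^r : A^{⊗ r} → A` (the fold map of
the coproduct). -/
noncomputable def GTensorPower.mu {A : Type} [GCA A] {r : ℕ} {T : Type} [GCA T]
    (TP : GTensorPower A r T) : T →ₐ[ℚ] A :=
  (TP.coprod A (fun _ => AlgHom.id ℚ A) (fun _ => isGCAHom_id A)).choose

/-- `A` is the exterior algebra (free graded-commutative algebra) on `l`
generators `z₁,…,z_l` of odd degree, characterized by its universal
property. -/
structure FreeOddGCA (l : ℕ) (A : Type) [GCA A] where
  z : Fin l → A
  deg : Fin l → ℕ
  deg_odd : ∀ i, Odd (deg i)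
  z_mem : ∀ i, z i ∈ Grc A (deg i)
  free : ∀ (B : Type) [GCA B] (b : Fin l → B), (∀ i, b i ∈ Grc B (deg i)) →
    ∃! g : A →ₐ[ℚ] B, IsGCAHom g ∧ ∀ i, g (z i) = b i

theorem iSup_Grc (T : Type) [GCA T] : ⨆ n, Grc T n = ⊤ :=
  letI := GCA.gradedAlgebra (A := T)
  (DirectSum.Decomposition.isInternal (GCA.grading (A := T))).submodule_iSup_eq_top

theorem iSupIndep_Grc (T : Type) [GCA T] : iSupIndep (Grc T) :=
  letI := GCA.gradedAlgebra (A := T)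
  (DirectSum.Decomposition.isInternal (GCA.grading (A := T))).submodule_iSupIndep

theorem one_mem_Grc (T : Type) [GCA T] : (1 : T) ∈ Grc T 0 :=
  letI := GCA.gradedAlgebra (A := T)
  SetLike.GradedOne.one_mem (A := GCA.grading (A := T))

theorem mul_mem_Grc {T : Type} [GCA T] {i j : ℕ} {a b : T} (ha : a ∈ Grc T i)
    (hb : b ∈ Grc T j) : a * b ∈ Grc T (i + j) :=
  letI := GCA.gradedAlgebra (A := T)
  SetLike.GradedMul.mul_mem (A := GCA.grading (A := T)) ha hb

/-- The subalgebra generated by homogeneous elements is the sum of its homogeneous parts. -/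
theorem adjoin_le_iSup_inf_Grc {T : Type} [GCA T] {G : Set T}
    (hG : ∀ g ∈ G, ∃ n, g ∈ Grc T n) :
    Subalgebra.toSubmodule (Algebra.adjoin ℚ G) ≤
      ⨆ n, Subalgebra.toSubmodule (Algebra.adjoin ℚ G) ⊓ Grc T n := by
  set S := Subalgebra.toSubmodule (Algebra.adjoin ℚ G) with hS
  intro x hx
  have hx' : x ∈ Algebra.adjoin ℚ G := hx
  induction hx' using Algebra.adjoin_induction with
  | mem x h =>
    obtain ⟨n, hn⟩ := hG x h
    exact Submodule.mem_iSup_of_mem n ⟨Algebra.subset_adjoin h, hn⟩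
  | algebraMap q =>
    refine Submodule.mem_iSup_of_mem 0 ⟨hx, ?_⟩
    rw [Algebra.algebraMap_eq_smul_one]
    exact Submodule.smul_mem _ _ (one_mem_Grc T)
  | add x y hx₁ hy₁ hx₂ hy₂ => exact add_mem (hx₂ hx₁) (hy₂ hy₁)
  | mul x y hx₁ hy₁ hx₂ hy₂ =>
    have key : (⨆ n, S ⊓ Grc T n) * (⨆ n, S ⊓ Grc T n) ≤ ⨆ n, S ⊓ Grc T n := by
      rw [Submodule.iSup_mul]
      refine iSup_le fun i => ?_
      rw [Submodule.mul_iSup]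
      refine iSup_le fun j => ?_
      rw [Submodule.mul_le]
      rintro a ⟨ha, ha'⟩ b ⟨hb, hb'⟩
      exact Submodule.mem_iSup_of_mem (i + j)
        ⟨(Algebra.adjoin ℚ G).mul_mem ha hb, mul_mem_Grc ha' hb'⟩
    exact key (Submodule.mul_mem_mul (hx₂ hx₁) (hy₂ hy₁))

/-- A subalgebra which is the sum of its homogeneous parts, with the induced grading. -/
@[reducible]
def subalgebraGCA {T : Type} [GCA T] (S : Subalgebra ℚ T)
    (h : Subalgebra.toSubmodule S ≤ ⨆ n, Subalgebra.toSubmodule S ⊓ Grc T n) : GCA S :=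
  { (inferInstance : Ring S), (inferInstance : Algebra ℚ S) with
    grading := fun n => (Grc T n).comap S.val.toLinearMap
    gradedAlgebra := by
      have hinj : Function.Injective S.val.toLinearMap := Subtype.val_injective
      have hind : iSupIndep fun n => (Grc T n).comap S.val.toLinearMap := by
        have h₁ : iSupIndep fun n =>
            ((Grc T n).comap S.val.toLinearMap).map S.val.toLinearMap :=
          (iSupIndep_Grc T).mono fun n => Submodule.map_comap_le _ _
        intro i
        rw [Submodule.disjoint_def]
        intro x hx hx'
        refine hinj ?_
        rw [map_zero]
        refine Submodule.disjoint_def.1 (h₁ i) _ (Submodule.mem_map_of_mem hx) ?_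
        have := Submodule.mem_map_of_mem (f := S.val.toLinearMap) hx'
        simpa only [Submodule.map_iSup] using this
      have htop : ⨆ n, (Grc T n).comap S.val.toLinearMap = ⊤ := by
        refine Submodule.map_injective_of_injective hinj ?_
        refine le_antisymm (Submodule.map_mono le_top) ?_
        rw [Submodule.map_iSup]
        rintro _ ⟨x, -, rfl⟩
        refine SetLike.le_def.1 (iSup_mono fun n => ?_) (h x.2)
        rintro y ⟨hy, hy'⟩
        exact ⟨⟨y, hy⟩, hy', rfl⟩
      have hint := (DirectSum.isInternal_submodule_iff_iSupIndep_and_iSup_eq_top _).2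
        ⟨hind, htop⟩
      exact
        { toGradedMonoid :=
            { one_mem := one_mem_Grc T
              mul_mem := fun _ _ _ _ ha hb => mul_mem_Grc ha hb }
          toDecomposition := hint.chooseDecomposition }
    grading_comm := fun i j a b ha hb =>
      Subtype.ext (GCA.grading_comm i j (a : T) (b : T) ha hb) }

/-- The graded tensor power of an exterior algebra is generated by the copies of the
generators. -/
theorem GTensorPower.adjoin_eq_top {l : ℕ} {A : Type} [GCA A] (hA : FreeOddGCA l A)
    {r : ℕ} {T : Type} [GCA T] (TP : GTensorPower A r T) :
    Algebra.adjoin ℚ (Set.range fun p : Fin l × Fin r => TP.ι p.2 (hA.z p.1)) = ⊤ := by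
  set S := Algebra.adjoin ℚ (Set.range fun p : Fin l × Fin r => TP.ι p.2 (hA.z p.1)) with hS
  have hhom : Subalgebra.toSubmodule S ≤ ⨆ n, Subalgebra.toSubmodule S ⊓ Grc T n := by
    refine adjoin_le_iSup_inf_Grc ?_
    rintro _ ⟨p, rfl⟩
    exact ⟨_, TP.ι_hom p.2 _ _ (hA.z_mem p.1)⟩
  let _ : GCA S := subalgebraGCA S hhom
  have hval : IsGCAHom S.val := fun _ _ h => h
  have hmem : ∀ i j, TP.ι j (hA.z i) ∈ S := fun i j => Algebra.subset_adjoin ⟨(i, j), rfl⟩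
  have hf : ∀ j, ∃ f : A →ₐ[ℚ] S, IsGCAHom f ∧ S.val.comp f = TP.ι j := by
    intro j
    obtain ⟨f, ⟨hf, hfz⟩, -⟩ := hA.free S (fun i => ⟨TP.ι j (hA.z i), hmem i j⟩)
      fun i => TP.ι_hom j _ _ (hA.z_mem i)
    refine ⟨f, hf, (hA.free T (fun i => TP.ι j (hA.z i))
      fun i => TP.ι_hom j _ _ (hA.z_mem i)).unique
        ⟨fun i a ha => hval i _ (hf i a ha), fun i => ?_⟩ ⟨TP.ι_hom j, fun i => rfl⟩⟩
    exact congrArg S.val (hfz i)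
  choose f hf hfι using hf
  obtain ⟨g, ⟨hg, hgι⟩, -⟩ := TP.coprod S f hf
  have hid : S.val.comp g = AlgHom.id ℚ T :=
    (TP.coprod T TP.ι TP.ι_hom).unique
      ⟨fun i a ha => hval i _ (hg i a ha), fun j => by rw [AlgHom.comp_assoc, hgι, hfι]⟩
      ⟨isGCAHom_id T, fun j => AlgHom.id_comp _⟩
  refine eq_top_iff.2 fun t _ => ?_
  have := DFunLike.congr_fun hid t
  rw [AlgHom.id_apply] at this
  rw [← this]
  exact (g t).2

theorem GTensorPower.mu_ι {A : Type} [GCA A] {r : ℕ} {T : Type} [GCA T]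
    (TP : GTensorPower A r T) (j : Fin r) (a : A) : TP.mu (TP.ι j a) = a :=
  DFunLike.congr_fun
    ((TP.coprod A (fun _ => AlgHom.id ℚ A) (fun _ => isGCAHom_id A)).choose_spec.1.2 j) a

/-- A subspace of pairwise anticommuting elements is nilpotent of order exceeding its
dimension. -/
theorem pow_eq_bot_of_anticomm {T : Type*} [Ring T] [Algebra ℚ T] (D : Submodule ℚ T)
    [FiniteDimensional ℚ D] (hD : ∀ x ∈ D, ∀ y ∈ D, x * y = -(y * x)) {n : ℕ}
    (hn : Module.finrank ℚ D < n) : D ^ n = ⊥ := by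
  have := IsAddTorsionFree.of_module_rat T
  have hsq : ∀ x : D, D.subtype x * D.subtype x = 0 := fun x =>
    self_eq_neg.1 (hD x x.2 x x.2)
  have hext : (⋀[ℚ]^n D : Submodule ℚ (ExteriorAlgebra ℚ D)) = ⊥ := by
    rw [← ExteriorAlgebra.ιMulti_span_fixedDegree, Submodule.span_eq_bot]
    rintro _ ⟨v, rfl⟩
    refine AlternatingMap.map_linearDependent _ v fun hv => ?_
    have := hv.fintype_card_le_finrank
    rw [Fintype.card_fin] at this
    omega
  have hmap := congrArg
    (Submodule.map (ExteriorAlgebra.lift ℚ ⟨D.subtype, hsq⟩).toLinearMap) hext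
  rw [Submodule.map_bot, ExteriorAlgebra.exteriorPower, Submodule.map_pow] at hmap
  rw [← hmap, ← LinearMap.range_comp]
  congr 1
  have : (ExteriorAlgebra.lift ℚ ⟨D.subtype, hsq⟩).toLinearMap ∘ₗ ExteriorAlgebra.ι ℚ =
      D.subtype := ExteriorAlgebra.ι_comp_lift ℚ _ hsq
  rw [this, Submodule.range_subtype]

theorem top_mul_pow_le {T : Type*} [Ring T] [Algebra ℚ T] {D : Submodule ℚ T}
    (hD : D * ⊤ ≤ ⊤ * D) (n : ℕ) : (⊤ * D) ^ n ≤ ⊤ * D ^ n := by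
  induction n with
  | zero =>
    rw [pow_zero, pow_zero, mul_one]
    exact le_top
  | succ n ih =>
    calc (⊤ * D) ^ (n + 1) = (⊤ * D) * (⊤ * D) ^ n := pow_succ' _ _
      _ ≤ (⊤ * D) * (⊤ * D ^ n) := mul_le_mul' le_rfl ih
      _ = ⊤ * (D * ⊤) * D ^ n := by simp only [mul_assoc]
      _ ≤ ⊤ * (⊤ * D) * D ^ n :=
        mul_le_mul' (mul_le_mul' le_rfl hD) le_rfl
      _ = (⊤ * ⊤) * D ^ (n + 1) := by rw [pow_succ']; simp only [mul_assoc]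
      _ ≤ ⊤ * D ^ (n + 1) := mul_le_mul' le_top le_rfl

/-- A left ideal generated by homogeneous elements is two-sided. -/
theorem span_mul_top_le {T : Type} [GCA T] {G : Set T} (hG : ∀ g ∈ G, ∃ n, g ∈ Grc T n) :
    Submodule.span ℚ G * ⊤ ≤ ⊤ * Submodule.span ℚ G := by
  rw [← iSup_Grc T, Submodule.mul_iSup]
  refine iSup_le fun j => ?_
  rw [iSup_Grc, Submodule.mul_le]
  intro x hx t ht
  induction hx using Submodule.span_induction with
  | mem x h =>
    obtain ⟨i, hi⟩ := hG x h
    rw [GCA.grading_comm i j x t hi ht]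
    exact Submodule.smul_mem _ _
      (Submodule.mul_mem_mul Submodule.mem_top (Submodule.subset_span h))
  | zero => simp
  | add x y _ _ hx hy =>
    rw [add_mul]
    exact add_mem hx hy
  | smul q x _ hx =>
    rw [smul_mul_assoc]
    exact Submodule.smul_mem _ _ hx

theorem span_anticomm_of_odd {T : Type} [GCA T] {G : Set T}
    (hG : ∀ g ∈ G, ∃ n, Odd n ∧ g ∈ Grc T n) :
    ∀ x ∈ Submodule.span ℚ G, ∀ y ∈ Submodule.span ℚ G, x * y = -(y * x) := by
  intro x hx y hy
  induction hx, hy using Submodule.span_induction₂ with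
  | mem_mem x y hx hy =>
    obtain ⟨i, hi, hi'⟩ := hG x hx
    obtain ⟨j, hj, hj'⟩ := hG y hy
    rw [GCA.grading_comm i j x y hi' hj', (hi.mul hj).neg_one_pow, neg_one_smul]
  | zero_left y _ => simp
  | zero_right x _ => simp
  | add_left x y z _ _ _ h₁ h₂ => rw [add_mul, mul_add, h₁, h₂, neg_add]
  | add_right x y z _ _ _ h₁ h₂ => rw [add_mul, mul_add, h₁, h₂, neg_add]
  | smul_left q x y _ _ h => rw [smul_mul_assoc, mul_smul_comm, h, smul_neg]
  | smul_right q x y _ _ h => rw [smul_mul_assoc, mul_smul_comm, h, smul_neg]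

/-- An element killed by `μ` lies in the ideal generated by the differences of copies of the
generators. -/
theorem GTensorPower.ker_mu_le {l : ℕ} {A : Type} [GCA A] (hA : FreeOddGCA l A)
    {r : ℕ} {T : Type} [GCA T] (TP : GTensorPower A r T) (j₀ : Fin r)
    {D : Submodule ℚ T} (hD : D * ⊤ ≤ ⊤ * D)
    (hmem : ∀ i j, j ≠ j₀ → TP.ι j (hA.z i) - TP.ι j₀ (hA.z i) ∈ D) :
    LinearMap.ker TP.mu.toLinearMap ≤ ⊤ * D := by
  have hsub : ∀ t : T, t - TP.ι j₀ (TP.mu t) ∈ (⊤ * D : Submodule ℚ T) := by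
    intro t
    have ht : t ∈ Algebra.adjoin ℚ
        (Set.range fun p : Fin l × Fin r => TP.ι p.2 (hA.z p.1)) := by
      rw [TP.adjoin_eq_top hA]
      exact Algebra.mem_top
    induction ht using Algebra.adjoin_induction with
    | mem x h =>
      obtain ⟨⟨i, j⟩, rfl⟩ := h
      simp only [TP.mu_ι]
      by_cases hj : j = j₀
      · simp [hj]
      · rw [← one_mul (_ - _)]
        exact Submodule.mul_mem_mul Submodule.mem_top (hmem i j hj)
    | algebraMap q => simp
    | add x y _ _ hx hy =>
      rw [map_add, map_add, add_sub_add_comm]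
      exact add_mem hx hy
    | mul x y _ _ hx hy =>
      have e : x * y - TP.ι j₀ (TP.mu (x * y)) = x * (y - TP.ι j₀ (TP.mu y)) +
          (x - TP.ι j₀ (TP.mu x)) * TP.ι j₀ (TP.mu y) := by
        rw [map_mul, map_mul]
        noncomm_ring
      have h₁ : ⊤ * (⊤ * D) ≤ ⊤ * D := by
        rw [← mul_assoc]
        exact mul_le_mul' le_top le_rfl
      have h₂ : ⊤ * D * ⊤ ≤ ⊤ * D := by
        rw [mul_assoc]
        exact (mul_le_mul' le_rfl hD).trans h₁
      rw [e]
      exact add_mem (h₁ (Submodule.mul_mem_mul Submodule.mem_top hy))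
        (h₂ (Submodule.mul_mem_mul hx Submodule.mem_top))
  intro t ht
  have ht' : TP.mu t = 0 := ht
  simpa [ht'] using hsub t

/-- For the exterior algebra `Λ(z₁,…,z_l)` on `l` generators
of odd degree and `r ≥ 2`, the kernel of the `r`-fold multiplication
`μ^r : (Λ(z₁,…,z_l))^{⊗r} → Λ(z₁,…,z_l)` satisfies
`(ker μ^r)^{l(r−1)+1} = 0` (in particular `(ker μ^r_{Λu})^r = 0` for a single
odd generator `u`). -/
theorem ker_mu_pow_exterior (l : ℕ) (A : Type) [GCA A] (hA : FreeOddGCA l A)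
    (r : ℕ) (hr : 2 ≤ r) (T : Type) [GCA T] (TP : GTensorPower A r T) :
    (LinearMap.ker TP.mu.toLinearMap) ^ (l * (r - 1) + 1) = ⊥ := by
  let j₀ : Fin r := ⟨0, by omega⟩
  let d : Fin l × {j : Fin r // j ≠ j₀} → T := fun p =>
    TP.ι p.2 (hA.z p.1) - TP.ι j₀ (hA.z p.1)
  have hodd : ∀ g ∈ Set.range d, ∃ n, Odd n ∧ g ∈ Grc T n := by
    rintro _ ⟨p, rfl⟩
    exact ⟨_, hA.deg_odd p.1, sub_mem (TP.ι_hom _ _ _ (hA.z_mem p.1))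
      (TP.ι_hom _ _ _ (hA.z_mem p.1))⟩
  have hcomm := span_mul_top_le fun g hg => (hodd g hg).imp fun _ h => h.2
  have hrank : Module.finrank ℚ (Submodule.span ℚ (Set.range d)) ≤ l * (r - 1) := by
    refine (finrank_range_le_card d).trans_eq ?_
    simp [Fintype.card_subtype_compl]
  have : FiniteDimensional ℚ (Submodule.span ℚ (Set.range d)) :=
    FiniteDimensional.span_of_finite ℚ (Set.finite_range d)
  have hker := TP.ker_mu_le hA j₀ hcomm fun i j hj =>
    Submodule.subset_span ⟨(i, ⟨j, hj⟩), rfl⟩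
  rw [eq_bot_iff]
  calc (LinearMap.ker TP.mu.toLinearMap) ^ (l * (r - 1) + 1)
      ≤ (⊤ * Submodule.span ℚ (Set.range d)) ^ (l * (r - 1) + 1) := pow_le_pow_left' hker _
    _ ≤ ⊤ * Submodule.span ℚ (Set.range d) ^ (l * (r - 1) + 1) := top_mul_pow_le hcomm _
    _ = ⊥ := by
      rw [pow_eq_bot_of_anticomm _ (span_anticomm_of_odd hodd) (Nat.lt_succ_of_le hrank),
        Submodule.mul_bot]

end RHT
end
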